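/- (Alignment of the MGM and per-step quantifications) Let T ≥ 1 and let Σ be a real symmetric positive definite T×T matrix. Then −½ log det R(Σ) = ½ · ∑_{t=0}^{T−1} log( Σ_{tt} / s_t(Σ) ); that is, the multivariate-Gaussian quantification of the non-deterministic EOB equals the sum over time steps of the per-step Gaussian information gains ½ log(Σ_{tt}/s_t). -/

import Mathlib

open Matrix

/-- The correlation matrix: `R(Σ)_{ij} = Σ_{ij} / √(Σ_{ii} Σ_{jj})`. -/
noncomputable def corrMat {T : ℕ} (S : Matrix (Fin T) (Fin T) ℝ) :
    Matrix (Fin T) (Fin T) ℝ :=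
  fun i j => S i j / Real.sqrt (S i i * S j j)

/-- The `k×k` leading principal submatrix of a `T×T` matrix (0-based indices). -/
def lead {T : ℕ} (S : Matrix (Fin T) (Fin T) ℝ) (k : ℕ) (hk : k ≤ T) :
    Matrix (Fin k) (Fin k) ℝ :=
  S.submatrix (Fin.castLE hk) (Fin.castLE hk)

/-- The innovation variances: `s_0(Σ) = Σ_{00}` and, for `t ≥ 1`,
`s_t(Σ) = Σ_{tt} − b_tᵀ (Σ^{(t)})⁻¹ b_t` with `b_t = (Σ_{it})_{i<t}`. -/
noncomputable def innov {T : ℕ} (S : Matrix (Fin T) (Fin T) ℝ) (t : Fin T) : ℝ :=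
  S t t -
    (fun i : Fin t.val => S (Fin.castLE t.isLt.le i) t) ⬝ᵥ
      ((lead S t.val t.isLt.le)⁻¹ *ᵥ fun i : Fin t.val => S (Fin.castLE t.isLt.le i) t)

theorem lead_posDef {T : ℕ} (S : Matrix (Fin T) (Fin T) ℝ) (hS : S.PosDef) (k : ℕ) (hk : k ≤ T) :
    (lead S k hk).PosDef :=
  hS.submatrix (Fin.castLE_injective hk)

theorem det_lead_succ {T : ℕ} (S : Matrix (Fin T) (Fin T) ℝ) (hS : S.PosDef) (k : ℕ)
    (hk : k < T) :
    (lead S (k + 1) hk).det = (lead S k hk.le).det * innov S ⟨k, hk⟩ := by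
  have hdet := (lead_posDef S hS k hk.le).det_pos
  letI : Invertible (lead S k hk.le) :=
    Matrix.invertibleOfIsUnitDet _ (isUnit_iff_ne_zero.mpr hdet.ne')
  have hsymm : ∀ i j, S i j = S j i := fun i j => by
    have := hS.isHermitian.apply j i
    simpa using this
  have e : (lead S (k + 1) hk).submatrix (finSumFinEquiv (m := k) (n := 1))
      (finSumFinEquiv (m := k) (n := 1)) =
      Matrix.fromBlocks (lead S k hk.le)
        (Matrix.of fun i (_ : Fin 1) => S (Fin.castLE hk.le i) ⟨k, hk⟩)
        (Matrix.of fun (_ : Fin 1) i => S (Fin.castLE hk.le i) ⟨k, hk⟩)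
        (Matrix.of fun _ _ => S ⟨k, hk⟩ ⟨k, hk⟩) := by
    ext i j
    rcases i with i | i <;> rcases j with j | j
    · rfl
    · obtain rfl : j = 0 := Subsingleton.elim _ _
      rfl
    · obtain rfl : i = 0 := Subsingleton.elim _ _
      exact hsymm _ _
    · obtain rfl : j = 0 := Subsingleton.elim _ _
      obtain rfl : i = 0 := Subsingleton.elim _ _
      rfl
  rw [← Matrix.det_submatrix_equiv_self (finSumFinEquiv (m := k) (n := 1)), e,
    Matrix.det_fromBlocks₁₁, Matrix.det_fin_one, Matrix.invOf_eq_nonsing_inv, Matrix.mul_assoc]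
  rfl

theorem innov_pos {T : ℕ} (S : Matrix (Fin T) (Fin T) ℝ) (hS : S.PosDef) (t : Fin T) :
    0 < innov S t := by
  have h := det_lead_succ S hS t.1 t.2
  have h1 := (lead_posDef S hS _ t.2).det_pos
  have h0 := (lead_posDef S hS _ t.2.le).det_pos
  exact (mul_pos_iff_of_pos_left h0).mp (h ▸ h1)

theorem det_lead {T : ℕ} (S : Matrix (Fin T) (Fin T) ℝ) (hS : S.PosDef) (k : ℕ) (hk : k ≤ T) :
    (lead S k hk).det = ∏ i : Fin k, innov S (Fin.castLE hk i) := by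
  induction k with
  | zero => simp
  | succ k ih =>
    rw [det_lead_succ S hS k hk, ih (Nat.le_of_succ_le hk), Fin.prod_univ_castSucc]
    rfl

theorem det_corr {T : ℕ} (S : Matrix (Fin T) (Fin T) ℝ) (hS : S.PosDef) :
    (corrMat S).det = ∏ t : Fin T, (innov S t / S t t) := by
  have e : corrMat S = Matrix.diagonal (fun i => (Real.sqrt (S i i))⁻¹) * S *
      Matrix.diagonal (fun i => (Real.sqrt (S i i))⁻¹) := by
    ext i j
    rw [Matrix.mul_diagonal, Matrix.diagonal_mul, corrMat,
      Real.sqrt_mul (hS.diag_pos (i := i)).le, div_eq_mul_inv, mul_inv]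
    ring
  have hd : S.det = ∏ t, innov S t := det_lead S hS T le_rfl
  rw [e, Matrix.det_mul, Matrix.det_mul, Matrix.det_diagonal, hd, ← Finset.prod_mul_distrib,
    ← Finset.prod_mul_distrib]
  refine Finset.prod_congr rfl fun t _ => ?_
  have h := hS.diag_pos (i := t)
  have h2 := Real.mul_self_sqrt h.le
  rw [mul_comm, ← mul_assoc, ← mul_inv, h2, div_eq_inv_mul]

/-- Alignment of the MGM and per-step quantifications of the non-deterministic EOB:
`−½ log det R(Σ) = ½ ∑ₜ log(Σ_{tt} / s_t(Σ))`. -/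
theorem neg_half_log_det_corr_eq_sum_info_gains {T : ℕ} (hT : 1 ≤ T)
    (S : Matrix (Fin T) (Fin T) ℝ) (hS : S.PosDef) :
    -(1 / 2 : ℝ) * Real.log (corrMat S).det
      = 1 / 2 * ∑ t : Fin T, Real.log (S t t / innov S t) := by
  rw [det_corr S hS, Real.log_prod fun t _ =>
    (div_pos (innov_pos S hS t) hS.diag_pos).ne', neg_mul, ← mul_neg, ← Finset.sum_neg_distrib]
  congr 1
  refine Finset.sum_congr rfl fun t _ => ?_
  rw [← Real.log_inv, inv_div]
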